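/- arXiv:2107.12264 — 8 statements merged into one kernel-verified Lean document; each statement's English description precedes it below -/
import Mathlib

section
/- Let F₀ and c be positive real numbers, let I ⊆ ℝ be an open interval containing 0, and let f : ℝ → ℝ be differentiable on I with f(0) = 1 and f′(t) = c·F₀²·f(t)³ for all t ∈ I. Then for every t ∈ I one has 2cF₀²t < 1 and f(t) = (1 − 2cF₀²t)^(−1/2). -/
/-- A function with everywhere vanishing derivative on an open interval is constant there. -/
theorem eq_of_hasDerivAt_zero {I : Set ℝ} (hI : IsOpen I) (hconn : I.OrdConnected) {g : ℝ → ℝ}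
    (hg : ∀ t ∈ I, HasDerivAt g 0 t) {s t : ℝ} (hs : s ∈ I) (ht : t ∈ I) : g s = g t :=
  hI.is_const_of_deriv_eq_zero hconn.isPreconnected
    (fun x hx => (hg x hx).differentiableAt.differentiableWithinAt)
    (fun x hx => (hg x hx).deriv) hs ht

/-- The solution of a scalar linear homogeneous ODE on an open interval, via the integrating
factor. -/
theorem eq_mul_exp_integral_of_hasDerivAt {I : Set ℝ} (hI : IsOpen I) (hconn : I.OrdConnected)
    {f a : ℝ → ℝ} (ha : ContinuousOn a I) (hf : ∀ t ∈ I, HasDerivAt f (a t * f t) t)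
    {s t : ℝ} (hs : s ∈ I) (ht : t ∈ I) :
    f t = f s * Real.exp (∫ x in s..t, a x) := by
  have hA : ∀ t ∈ I, HasDerivAt (fun y => ∫ x in s..y, a x) (a t) t := fun t ht =>
    intervalIntegral.integral_hasDerivAt_right
      ((ha.mono (hconn.uIcc_subset hs ht)).intervalIntegrable)
      (ha.stronglyMeasurableAtFilter hI t ht) (ha.continuousAt (hI.mem_nhds ht))
  have hconst := eq_of_hasDerivAt_zero hI hconn
    (g := fun y => f y * Real.exp (-∫ x in s..y, a x))
    (fun t ht => ((hf t ht).mul (hA t ht).neg.exp).congr_deriv (by ring)) ht hs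
  simp only [intervalIntegral.integral_same, neg_zero, Real.exp_zero, mul_one] at hconst
  rw [← hconst, mul_assoc, ← Real.exp_add, neg_add_cancel, Real.exp_zero, mul_one]


/-- Uniqueness for the IVP `f' = c·F₀²·f³`, `f(0) = 1`, on an open interval `I` containing `0`:
any solution satisfies `2cF₀²t < 1` and `f(t) = (1 - 2cF₀²t)^(-1/2)` on `I`. -/
theorem stmt1 (F₀ c : ℝ) (hF₀ : 0 < F₀) (hc : 0 < c)
    (I : Set ℝ) (hIopen : IsOpen I) (hIconn : I.OrdConnected) (h0I : (0 : ℝ) ∈ I)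
    (f : ℝ → ℝ) (hf0 : f 0 = 1)
    (hode : ∀ t ∈ I, HasDerivAt f (c * F₀ ^ 2 * (f t) ^ 3) t) :
    ∀ t ∈ I, 2 * c * F₀ ^ 2 * t < 1 ∧
      f t = (1 - 2 * c * F₀ ^ 2 * t) ^ (-(1 / 2) : ℝ) := by
  intro t ht
  have hcont : ContinuousOn f I := fun x hx => (hode x hx).continuousAt.continuousWithinAt
  have hpos : ∀ x ∈ I, 0 < f x := fun x hx => by
    rw [eq_mul_exp_integral_of_hasDerivAt hIopen hIconn (a := fun y => c * F₀ ^ 2 * f y ^ 2)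
      (by fun_prop) (fun y hy => (hode y hy).congr_deriv (by ring)) h0I hx, hf0, one_mul]
    exact Real.exp_pos _
  have hconst := eq_of_hasDerivAt_zero hIopen hIconn
    (g := fun y => (f y ^ 2)⁻¹ + 2 * c * F₀ ^ 2 * y)
    (fun x hx => by
      have hx0 := (hpos x hx).ne'
      refine ((((hode x hx).pow 2).inv (pow_ne_zero 2 hx0)).add
        ((hasDerivAt_id x).const_mul (2 * c * F₀ ^ 2))).congr_deriv ?_
      simp only [Pi.pow_apply]
      field_simp
      ring) ht h0I
  simp only [hf0, one_pow, inv_one, mul_zero, add_zero] at hconst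
  have hft := hpos t ht
  have hinv : 1 - 2 * c * F₀ ^ 2 * t = (f t ^ 2)⁻¹ := by linarith
  refine ⟨?_, ?_⟩
  · have : 0 < (f t ^ 2)⁻¹ := by positivity
    linarith
  · rw [hinv, Real.rpow_neg (by positivity), ← Real.sqrt_eq_rpow, Real.sqrt_inv,
      Real.sqrt_sq hft.le, inv_inv]
end

section
/- Let F₀ > 0 and w > 0 be real numbers and set c = w²/2. Define a(t) = (F₀/c)·(exp(cF₀²t) − 1) for t ∈ ℝ. Then a(0) = 0; for every t ∈ ℝ one has 1 + (c/F₀)·a(t) = exp(cF₀²t) > 0 and a is differentiable at t with a′(t) = F₀³·(1 + (c/F₀)·a(t))^(w²/c − 1); moreover F₀·(1 + (c/F₀)·a(t))^(w²/(4c)) = F₀·exp(cF₀²t/2) and (w²/2)·(1 + (c/F₀)·a(t))^(w²/(2c) − 2) = (w²/2)·exp(−cF₀²t) for every t ∈ ℝ. -/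
/-- The eternal case `c = w²/2`: the function `a(t) = (F₀/c)(exp(cF₀²t) - 1)` satisfies
`a(0) = 0`, `1 + (c/F₀)a(t) = exp(cF₀²t) > 0`, the ODE
`a'(t) = F₀³(1 + (c/F₀)a(t))^(w²/c - 1)`, and the norm and Nijenhuis identities. -/
theorem stmt2 (F₀ w c : ℝ) (hF₀ : 0 < F₀) (hw : 0 < w) (hc : c = w ^ 2 / 2)
    (a : ℝ → ℝ)
    (ha : ∀ t : ℝ, a t = (F₀ / c) * (Real.exp (c * F₀ ^ 2 * t) - 1)) :
    a 0 = 0 ∧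
    (∀ t : ℝ,
      (1 + (c / F₀) * a t = Real.exp (c * F₀ ^ 2 * t) ∧
        0 < 1 + (c / F₀) * a t) ∧
      HasDerivAt a (F₀ ^ 3 * (1 + (c / F₀) * a t) ^ (w ^ 2 / c - 1 : ℝ)) t) ∧
    (∀ t : ℝ,
      F₀ * (1 + (c / F₀) * a t) ^ (w ^ 2 / (4 * c) : ℝ)
        = F₀ * Real.exp (c * F₀ ^ 2 * t / 2) ∧
      (w ^ 2 / 2) * (1 + (c / F₀) * a t) ^ (w ^ 2 / (2 * c) - 2 : ℝ)
        = (w ^ 2 / 2) * Real.exp (-(c * F₀ ^ 2 * t))) := by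
  have hF₀' : F₀ ≠ 0 := hF₀.ne'
  have hw2 : w ^ 2 = 2 * c := by linarith
  have hc0 : c ≠ 0 := by
    rw [hc]
    positivity
  have base_eq : ∀ t : ℝ, 1 + (c / F₀) * a t = Real.exp (c * F₀ ^ 2 * t) := by
    intro t
    rw [ha]
    field_simp
    ring
  have exponent_ode : w ^ 2 / c - 1 = 1 := by
    rw [hw2]
    field_simp
    norm_num
  have exponent_norm : w ^ 2 / (4 * c) = 1 / 2 := by
    rw [hw2]
    field_simp
    norm_num
  have exponent_nijenhuis : w ^ 2 / (2 * c) - 2 = -1 := by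
    rw [hw2]
    field_simp
    norm_num
  refine ⟨by simp [ha], fun t => ⟨⟨base_eq t, base_eq t ▸ Real.exp_pos _⟩, ?_⟩,
    fun t => ⟨?_, ?_⟩⟩
  · rw [exponent_ode, base_eq, Real.rpow_one, funext ha]
    have h := ((((hasDerivAt_id t).const_mul (c * F₀ ^ 2)).exp.sub_const 1).const_mul (F₀ / c))
    refine h.congr_deriv ?_
    simp only [id]
    field_simp
  · rw [exponent_norm, base_eq, ← Real.exp_mul]
    ring_nf
  · rw [exponent_nijenhuis, base_eq, ← Real.exp_mul]
    ring_nf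
end

section
/- Let F₀ > 0 and w > 0 be real numbers and let c satisfy w²/4 ≤ c < w²/2. Set T = 1/((w² − 2c)·F₀²) and b(t) = (2c − w²)·F₀²·t + 1. Then T > 0 and for every t < T: b(t) > 0; the function a(t) = (F₀/c)·(b(t)^(c/(2c−w²)) − 1) satisfies a(0) = 0 and 1 + (c/F₀)·a(t) = b(t)^(c/(2c−w²)) > 0; a is differentiable at t with a′(t) = F₀³·(1 + (c/F₀)·a(t))^(w²/c − 1); and F₀·(1 + (c/F₀)·a(t))^(w²/(4c)) = F₀·b(t)^(w²/(4(2c−w²))) as well as (w²/2)·(1 + (c/F₀)·a(t))^(w²/(2c) − 2) = (w²/2)·b(t)^((w²−4c)/(2(2c−w²))). -/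
/-- The ancient case `w²/4 ≤ c < w²/2`: with `T = 1/((w² - 2c)F₀²)` and
`b(t) = (2c - w²)F₀²t + 1`, one has `T > 0`, and for `t < T` the function
`a(t) = (F₀/c)(b(t)^(c/(2c - w²)) - 1)` satisfies `a(0) = 0`, positivity,
the ODE `a'(t) = F₀³(1 + (c/F₀)a(t))^(w²/c - 1)`, and the norm and Nijenhuis identities. -/
theorem stmt3 (F₀ w c : ℝ) (hF₀ : 0 < F₀) (hw : 0 < w)
    (hc₁ : w ^ 2 / 4 ≤ c) (hc₂ : c < w ^ 2 / 2)
    (T : ℝ) (hT : T = 1 / ((w ^ 2 - 2 * c) * F₀ ^ 2))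
    (b : ℝ → ℝ) (hb : ∀ t : ℝ, b t = (2 * c - w ^ 2) * F₀ ^ 2 * t + 1)
    (a : ℝ → ℝ)
    (ha : ∀ t : ℝ, a t = (F₀ / c) * ((b t) ^ (c / (2 * c - w ^ 2) : ℝ) - 1)) :
    0 < T ∧ a 0 = 0 ∧
    ∀ t : ℝ, t < T →
      0 < b t ∧
      (1 + (c / F₀) * a t = (b t) ^ (c / (2 * c - w ^ 2) : ℝ) ∧
        0 < 1 + (c / F₀) * a t) ∧
      HasDerivAt a (F₀ ^ 3 * (1 + (c / F₀) * a t) ^ (w ^ 2 / c - 1 : ℝ)) t ∧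
      F₀ * (1 + (c / F₀) * a t) ^ (w ^ 2 / (4 * c) : ℝ)
        = F₀ * (b t) ^ (w ^ 2 / (4 * (2 * c - w ^ 2)) : ℝ) ∧
      (w ^ 2 / 2) * (1 + (c / F₀) * a t) ^ (w ^ 2 / (2 * c) - 2 : ℝ)
        = (w ^ 2 / 2) * (b t) ^ ((w ^ 2 - 4 * c) / (2 * (2 * c - w ^ 2)) : ℝ) := by
  have hc : 0 < c := by nlinarith [pow_pos hw 2]
  have hd : 2 * c - w ^ 2 < 0 := by linarith
  have hd' : 2 * c - w ^ 2 ≠ 0 := hd.ne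
  have hc' : c ≠ 0 := hc.ne'
  have hF : F₀ ≠ 0 := hF₀.ne'
  have hpos : 0 < (w ^ 2 - 2 * c) * F₀ ^ 2 := mul_pos (by linarith) (pow_pos hF₀ 2)
  refine ⟨by rw [hT]; exact one_div_pos.mpr hpos, by simp [ha, hb], fun t ht => ?_⟩
  have hbt : 0 < b t := by
    rw [hT, lt_div_iff₀ hpos] at ht
    rw [hb]
    linarith
  have hu : 1 + (c / F₀) * a t = (b t) ^ (c / (2 * c - w ^ 2) : ℝ) := by
    rw [ha]
    field_simp
    ring
  refine ⟨hbt, ⟨hu, hu ▸ Real.rpow_pos_of_pos hbt _⟩, ?_, ?_, ?_⟩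
  · have hb' : HasDerivAt b ((2 * c - w ^ 2) * F₀ ^ 2) t := by
      rw [funext hb]
      simpa using ((hasDerivAt_id t).const_mul ((2 * c - w ^ 2) * F₀ ^ 2)).add_const 1
    have ha' := ((hb'.rpow_const (p := c / (2 * c - w ^ 2)) (Or.inl hbt.ne')).sub_const
      1).const_mul (F₀ / c)
    rw [hu, ← Real.rpow_mul hbt.le, funext ha]
    refine ha'.congr_deriv ?_
    have he : c / (2 * c - w ^ 2) * (w ^ 2 / c - 1) = c / (2 * c - w ^ 2) - 1 := by
      rw [div_sub_one hc', div_sub_one hd', div_mul_div_comm, div_eq_div_iff (mul_ne_zero hd' hc') hd']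
      ring
    rw [he]
    generalize 2 * c - w ^ 2 = d at hd' ⊢
    field_simp
  · rw [hu, ← Real.rpow_mul hbt.le]
    congr 2
    field_simp
  · rw [hu, ← Real.rpow_mul hbt.le]
    congr 2
    field_simp
    ring
end

section
/- Let F₀ > 0 and w > 0 be real numbers and let c satisfy c > w²/2. Set T = 1/((w² − 2c)·F₀²) and b(t) = (2c − w²)·F₀²·t + 1. Then T < 0 and for every t > T: b(t) > 0; the function a(t) = (F₀/c)·(b(t)^(c/(2c−w²)) − 1) satisfies a(0) = 0 and 1 + (c/F₀)·a(t) = b(t)^(c/(2c−w²)) > 0; a is differentiable at t with a′(t) = F₀³·(1 + (c/F₀)·a(t))^(w²/c − 1); and F₀·(1 + (c/F₀)·a(t))^(w²/(4c)) = F₀·b(t)^(w²/(4(2c−w²))) as well as (w²/2)·(1 + (c/F₀)·a(t))^(w²/(2c) − 2) = (w²/2)·b(t)^((w²−4c)/(2(2c−w²))). -/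
/-- The immortal case `c > w²/2`: with `T = 1/((w² - 2c)F₀²)` and
`b(t) = (2c - w²)F₀²t + 1`, one has `T < 0`, and for `t > T` the function
`a(t) = (F₀/c)(b(t)^(c/(2c - w²)) - 1)` satisfies `a(0) = 0`, positivity,
the ODE `a'(t) = F₀³(1 + (c/F₀)a(t))^(w²/c - 1)`, and the norm and Nijenhuis identities. -/
theorem stmt4 (F₀ w c : ℝ) (hF₀ : 0 < F₀) (hw : 0 < w)
    (hc : w ^ 2 / 2 < c)
    (T : ℝ) (hT : T = 1 / ((w ^ 2 - 2 * c) * F₀ ^ 2))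
    (b : ℝ → ℝ) (hb : ∀ t : ℝ, b t = (2 * c - w ^ 2) * F₀ ^ 2 * t + 1)
    (a : ℝ → ℝ)
    (ha : ∀ t : ℝ, a t = (F₀ / c) * ((b t) ^ (c / (2 * c - w ^ 2) : ℝ) - 1)) :
    T < 0 ∧ a 0 = 0 ∧
    ∀ t : ℝ, T < t →
      0 < b t ∧
      (1 + (c / F₀) * a t = (b t) ^ (c / (2 * c - w ^ 2) : ℝ) ∧
        0 < 1 + (c / F₀) * a t) ∧
      HasDerivAt a (F₀ ^ 3 * (1 + (c / F₀) * a t) ^ (w ^ 2 / c - 1 : ℝ)) t ∧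
      F₀ * (1 + (c / F₀) * a t) ^ (w ^ 2 / (4 * c) : ℝ)
        = F₀ * (b t) ^ (w ^ 2 / (4 * (2 * c - w ^ 2)) : ℝ) ∧
      (w ^ 2 / 2) * (1 + (c / F₀) * a t) ^ (w ^ 2 / (2 * c) - 2 : ℝ)
        = (w ^ 2 / 2) * (b t) ^ ((w ^ 2 - 4 * c) / (2 * (2 * c - w ^ 2)) : ℝ) := by
  have hd : 0 < 2 * c - w ^ 2 := by linarith
  have hc₀ : 0 < c := by nlinarith [sq_nonneg w]
  have hdF : 0 < (2 * c - w ^ 2) * F₀ ^ 2 := by positivity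
  have hT' : T = -(1 / ((2 * c - w ^ 2) * F₀ ^ 2)) := by
    rw [hT, ← div_neg]
    congr 1
    ring
  refine ⟨?_, ?_, fun t ht => ?_⟩
  · rw [hT']
    exact neg_neg_of_pos (by positivity)
  · simp [ha, hb]
  have hbt : 0 < b t := by
    have h := mul_lt_mul_of_pos_left ht hdF
    rw [hT', mul_neg, mul_one_div_cancel hdF.ne'] at h
    rw [hb]
    linarith
  have hat : 1 + (c / F₀) * a t = (b t) ^ (c / (2 * c - w ^ 2) : ℝ) := by
    rw [ha]
    field_simp
    ring
  have hpow (p q : ℝ) (hpq : c / (2 * c - w ^ 2) * p = q) :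
      (1 + (c / F₀) * a t) ^ p = (b t) ^ q := by
    rw [hat, ← Real.rpow_mul hbt.le, hpq]
  have hne : 2 * c - w ^ 2 ≠ 0 := hd.ne'
  refine ⟨hbt, ⟨hat, hat ▸ Real.rpow_pos_of_pos hbt _⟩, ?_, ?_, ?_⟩
  · have hb' : HasDerivAt b ((2 * c - w ^ 2) * F₀ ^ 2) t := by
      rw [funext hb]
      simpa using ((hasDerivAt_id t).const_mul ((2 * c - w ^ 2) * F₀ ^ 2)).add_const 1
    rw [hpow _ (c / (2 * c - w ^ 2) - 1) (by rw [div_sub_one hne]; field_simp; ring), funext ha]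
    refine (((hb'.rpow_const (p := c / (2 * c - w ^ 2)) (Or.inl hbt.ne')).sub_const 1).const_mul
      (F₀ / c)).congr_deriv ?_
    generalize (b t) ^ (c / (2 * c - w ^ 2) - 1 : ℝ) = x
    generalize 2 * c - w ^ 2 = d at hne ⊢
    field_simp
  · rw [hpow _ (w ^ 2 / (4 * (2 * c - w ^ 2))) (by field_simp)]
  · rw [hpow _ ((w ^ 2 - 4 * c) / (2 * (2 * c - w ^ 2))) (by field_simp; ring)]
end

section
/- Let F₀ > 0, c > 0 and w > 0 be real numbers, let I ⊆ ℝ be an open interval containing 0, and let a, F : ℝ → ℝ be differentiable on I with a(0) = 0 and F(0) = F₀. Assume that for every t ∈ I: F(t) > 0, F₀ + c·a(t) > 0, a′(t) = F(t)⁴/(F₀ + c·a(t)), and F′(t) = (w²/4)·F(t)⁵/(F₀ + c·a(t))². Then for every t ∈ I: F(t) = F₀·(1 + (c/F₀)·a(t))^(w²/(4c)) and a′(t) = F₀³·(1 + (c/F₀)·a(t))^(w²/c − 1). -/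
/-- The key ODE computation of Theorem `SolThm`: if `a` and `F` solve the coupled system
`a' = F⁴/(F₀ + c·a)`, `F' = (w²/4)·F⁵/(F₀ + c·a)²` on an open interval `I ∋ 0`, with
`a(0) = 0`, `F(0) = F₀`, and `F > 0`, `F₀ + c·a > 0` on `I`, then
`F(t) = F₀(1 + (c/F₀)a(t))^(w²/(4c))` and `a'(t) = F₀³(1 + (c/F₀)a(t))^(w²/c - 1)` on `I`. -/
theorem stmt5 (F₀ c w : ℝ) (hF₀ : 0 < F₀) (hc : 0 < c) (hw : 0 < w)
    (I : Set ℝ) (hIopen : IsOpen I) (hIconn : I.OrdConnected) (h0I : (0 : ℝ) ∈ I)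
    (a F : ℝ → ℝ) (ha0 : a 0 = 0) (hF0 : F 0 = F₀)
    (hFpos : ∀ t ∈ I, 0 < F t)
    (hapos : ∀ t ∈ I, 0 < F₀ + c * a t)
    (hode_a : ∀ t ∈ I, HasDerivAt a ((F t) ^ 4 / (F₀ + c * a t)) t)
    (hode_F : ∀ t ∈ I, HasDerivAt F ((w ^ 2 / 4) * (F t) ^ 5 / (F₀ + c * a t) ^ 2) t) :
    ∀ t ∈ I,
      F t = F₀ * (1 + (c / F₀) * a t) ^ (w ^ 2 / (4 * c) : ℝ) ∧
      HasDerivAt a (F₀ ^ 3 * (1 + (c / F₀) * a t) ^ (w ^ 2 / c - 1 : ℝ)) t := by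
  have hG : ∀ t ∈ I, HasDerivAt
      (fun s => Real.log (F s) - w ^ 2 / (4 * c) * Real.log (F₀ + c * a s)) 0 t := by
    intro t ht
    have hF := hFpos t ht
    have hA := hapos t ht
    have h1 := (hode_F t ht).log hF.ne'
    have h2 := ((((hode_a t ht).const_mul c).const_add F₀).log hA.ne').const_mul (w ^ 2 / (4 * c))
    refine (h1.sub h2).congr_deriv ?_
    field_simp
    ring
  have hconst : ∀ t ∈ I,
      Real.log (F t) - w ^ 2 / (4 * c) * Real.log (F₀ + c * a t) = Real.log F₀ - w ^ 2 / (4 * c) * Real.log F₀ := by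
    intro t ht
    have h := hIopen.is_const_of_deriv_eq_zero hIconn.isPreconnected
      (fun s hs => (hG s hs).differentiableAt.differentiableWithinAt)
      (fun s hs => (hG s hs).deriv) ht h0I
    simpa [ha0, hF0] using h
  intro t ht
  have hF := hFpos t ht
  have hA := hapos t ht
  have hu_eq : F₀ + c * a t = F₀ * (1 + (c / F₀) * a t) := by field_simp
  have hu : 0 < 1 + (c / F₀) * a t := by
    rw [hu_eq] at hA
    exact pos_of_mul_pos_right hA hF₀.le
  have hFt : F t = F₀ * (1 + (c / F₀) * a t) ^ (w ^ 2 / (4 * c) : ℝ) := by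
    have h := hconst t ht
    rw [hu_eq, Real.log_mul hF₀.ne' hu.ne'] at h
    refine Real.log_injOn_pos hF (mul_pos hF₀ (Real.rpow_pos_of_pos hu _)) ?_
    rw [Real.log_mul hF₀.ne' (Real.rpow_pos_of_pos hu _).ne', Real.log_rpow hu]
    linarith
  refine ⟨hFt, (hode_a t ht).congr_deriv ?_⟩
  have hpow : ((1 + (c / F₀) * a t) ^ (w ^ 2 / (4 * c) : ℝ)) ^ 4
      = (1 + (c / F₀) * a t) ^ (w ^ 2 / c : ℝ) := by
    rw [← Real.rpow_mul_natCast hu.le]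
    congr 1
    push_cast
    field_simp
  rw [hFt, hu_eq, mul_pow, hpow, Real.rpow_sub_one hu.ne', mul_div_mul_comm,
    pow_succ F₀ 3, mul_div_cancel_right₀ _ hF₀.ne']
end

section
/- Let F₀ > 0, w > 0 and c > 0 be real numbers with c ≠ w²/2. Let I ⊆ ℝ be an open interval containing 0 and let a : ℝ → ℝ be differentiable on I with a(0) = 0, such that for all t ∈ I one has 1 + (c/F₀)·a(t) > 0 and a′(t) = F₀³·(1 + (c/F₀)·a(t))^(w²/c − 1). Then for every t ∈ I: (2c − w²)·F₀²·t + 1 > 0 and a(t) = (F₀/c)·(((2c − w²)·F₀²·t + 1)^(c/(2c−w²)) − 1). -/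
/-- A positive solution of `u' = k u ^ (1 - p)` on an open interval satisfies
`u t ^ p = p k (t - t₀) + u t₀ ^ p` there. -/
theorem rpow_eq_of_hasDerivAt_mul_rpow_one_sub {k p : ℝ} {u : ℝ → ℝ} {I : Set ℝ}
    (hIopen : IsOpen I) (hIconn : I.OrdConnected) (hpos : ∀ t ∈ I, 0 < u t)
    (hode : ∀ t ∈ I, HasDerivAt u (k * u t ^ (1 - p)) t) {t₀ t : ℝ} (ht₀ : t₀ ∈ I) (ht : t ∈ I) :
    u t ^ p = p * k * (t - t₀) + u t₀ ^ p := by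
  have hpow : ∀ s ∈ I, HasDerivAt (fun s => u s ^ p) (p * k) s := fun s hs => by
    convert (hode s hs).rpow_const (p := p) (Or.inl (hpos s hs).ne') using 1
    have hinv : u s ^ (1 - p) * u s ^ (p - 1) = 1 := by
      rw [← Real.rpow_add (hpos s hs)]
      simp
    linear_combination -(p * k) * hinv
  have hlin : ∀ s : ℝ, HasDerivAt (fun s => p * k * (s - t₀) + u t₀ ^ p) (p * k) s := fun s => by
    simpa using (((hasDerivAt_id s).sub_const t₀).const_mul (p * k)).add_const (u t₀ ^ p)
  refine hIopen.eqOn_of_deriv_eq hIconn.isPreconnected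
    (fun s hs => (hpow s hs).differentiableAt.differentiableWithinAt)
    (fun s _ => (hlin s).differentiableAt.differentiableWithinAt)
    (fun s hs => (hpow s hs).deriv.trans (hlin s).deriv.symm) ht₀ ?_ ht
  simp

/-- Uniqueness for the IVP `a' = F₀³(1 + (c/F₀)a)^(w²/c - 1)`, `a(0) = 0`, when `c ≠ w²/2`:
any solution on an open interval `I ∋ 0` with `1 + (c/F₀)a > 0` satisfies
`(2c - w²)F₀²t + 1 > 0` and `a(t) = (F₀/c)(((2c - w²)F₀²t + 1)^(c/(2c - w²)) - 1)` on `I`. -/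
theorem stmt6 (F₀ w c : ℝ) (hF₀ : 0 < F₀) (hw : 0 < w) (hc : 0 < c)
    (hne : c ≠ w ^ 2 / 2)
    (I : Set ℝ) (hIopen : IsOpen I) (hIconn : I.OrdConnected) (h0I : (0 : ℝ) ∈ I)
    (a : ℝ → ℝ) (ha0 : a 0 = 0)
    (hpos : ∀ t ∈ I, 0 < 1 + (c / F₀) * a t)
    (hode : ∀ t ∈ I,
      HasDerivAt a (F₀ ^ 3 * (1 + (c / F₀) * a t) ^ (w ^ 2 / c - 1 : ℝ)) t) :
    ∀ t ∈ I,
      0 < (2 * c - w ^ 2) * F₀ ^ 2 * t + 1 ∧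
      a t = (F₀ / c) *
        (((2 * c - w ^ 2) * F₀ ^ 2 * t + 1) ^ (c / (2 * c - w ^ 2) : ℝ) - 1) := by
  intro t ht
  have hd : 2 * c - w ^ 2 ≠ 0 := fun h => hne (by linarith)
  have hu : ∀ s ∈ I, HasDerivAt (fun s => 1 + c / F₀ * a s)
      (c * F₀ ^ 2 * (1 + c / F₀ * a s) ^ (1 - (2 * c - w ^ 2) / c)) s := fun s hs => by
    refine (((hode s hs).const_mul (c / F₀)).const_add 1).congr_deriv ?_
    have hexp : 1 - (2 * c - w ^ 2) / c = w ^ 2 / c - 1 := by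
      field_simp
      ring
    rw [hexp]
    field_simp
  have hsol : (1 + c / F₀ * a t) ^ ((2 * c - w ^ 2) / c) = (2 * c - w ^ 2) * F₀ ^ 2 * t + 1 := by
    have h := rpow_eq_of_hasDerivAt_mul_rpow_one_sub hIopen hIconn hpos hu h0I ht
    simp only [ha0, mul_zero, add_zero, Real.one_rpow, sub_zero] at h
    rw [h]
    field_simp
  rw [← hsol]
  refine ⟨Real.rpow_pos_of_pos (hpos t ht) _, ?_⟩
  rw [← inv_div (2 * c - w ^ 2) c,
    Real.rpow_rpow_inv (hpos t ht).le (div_ne_zero hd hc.ne')]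
  field_simp
  ring
end

section
/- Let V be a 6-dimensional real inner product space, let J : V → V be an orthogonal complex structure, and let S : V → V be a self-adjoint linear map with S ∘ J = −J ∘ S. Then there exist an orthonormal basis e₁, …, e₆ of V and real numbers μ₁, μ₂, μ₃ such that for each k ∈ {1,2,3}: J(e_{2k−1}) = e_{2k}, S(e_{2k−1}) = μ_k·e_{2k−1}, and S(e_{2k}) = −μ_k·e_{2k}. -/
open scoped RealInnerProductSpace

open Module

/-- The orthogonal complement of the span of fewer than `dim V / 2` eigenvectors of `S` and
their images under `J` contains a unit eigenvector of `S`. -/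
theorem exists_unit_eigenvector_orthogonal {V : Type*} [NormedAddCommGroup V]
    [InnerProductSpace ℝ V] [FiniteDimensional ℝ V] {J S : V →ₗ[ℝ] V} (hS : S.IsSymmetric)
    (hSJ : ∀ x, S (J x) = -J (S x)) {m : ℕ} (hm : 2 * m < finrank ℝ V) (v : Fin m → V)
    (μ : Fin m → ℝ) (hv : ∀ i, S (v i) = μ i • v i) :
    ∃ (w : V) (c : ℝ), ⟪w, w⟫ = 1 ∧ S w = c • w ∧ (∀ i, ⟪v i, w⟫ = 0) ∧
      ∀ i, ⟪J (v i), w⟫ = 0 := by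
  set f : Fin m ⊕ Fin m → V := Sum.elim v (fun i => J (v i)) with hf
  set W : Submodule ℝ V := Submodule.span ℝ (Set.range f) with hW
  have mem_iff (x : V) : x ∈ Wᗮ ↔ ∀ i, ⟪f i, x⟫ = 0 := by
    rw [← Submodule.span_singleton_le_iff_mem, Submodule.le_orthogonal_iff_le_orthogonal, hW,
      Submodule.span_le, Set.range_subset_iff]
    refine forall_congr' fun i => ?_
    rw [SetLike.mem_coe, Submodule.mem_orthogonal_singleton_iff_inner_left]
  have hinv : ∀ x ∈ Wᗮ, S x ∈ Wᗮ := by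
    intro x hx
    rw [mem_iff] at hx ⊢
    rintro (i | i)
    · have h := hx (.inl i)
      simp only [hf, Sum.elim_inl] at h ⊢
      rw [← hS, hv, real_inner_smul_left, h, mul_zero]
    · have h := hx (.inr i)
      simp only [hf, Sum.elim_inr] at h ⊢
      rw [← hS, hSJ, hv, map_smul, inner_neg_left, real_inner_smul_left, h, mul_zero, neg_zero]
  have hpos : 0 < finrank ℝ Wᗮ := by
    have h₁ : finrank ℝ W ≤ 2 * m := by
      simpa [two_mul, Set.finrank] using finrank_range_le_card (R := ℝ) f
    have h₂ := W.finrank_add_finrank_orthogonal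
    lia
  have hT := hS.restrict_invariant hinv
  let b := hT.eigenvectorBasis rfl
  let i₀ : Fin (finrank ℝ Wᗮ) := ⟨0, hpos⟩
  have hw := (mem_iff _).1 (b i₀).2
  refine ⟨b i₀, hT.eigenvalues rfl i₀, ?_, ?_, fun i => hw (.inl i), fun i => hw (.inr i)⟩
  · rw [← Submodule.coe_inner, real_inner_self_eq_norm_sq, b.norm_eq_one, one_pow]
  · exact congrArg Subtype.val (hT.apply_eigenvectorBasis rfl i₀)

/-- A symmetric map `S` anticommuting with an orthogonal complex structure `J` admits `m` unitary
eigenvectors whenever `2 * m ≤ dim V`. -/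
theorem exists_unitary_eigenvectors {V : Type*} [NormedAddCommGroup V]
    [InnerProductSpace ℝ V] [FiniteDimensional ℝ V] {J S : V →ₗ[ℝ] V}
    (hJ2 : ∀ x, J (J x) = -x) (hJorth : ∀ x y, ⟪J x, J y⟫ = ⟪x, y⟫) (hS : S.IsSymmetric)
    (hSJ : ∀ x, S (J x) = -J (S x)) (m : ℕ) (hm : 2 * m ≤ finrank ℝ V) :
    ∃ (v : Fin m → V) (μ : Fin m → ℝ), (∀ i, S (v i) = μ i • v i) ∧
      (∀ i j, ⟪v i, v j⟫ = if i = j then 1 else 0) ∧ ∀ i j, ⟪J (v i), v j⟫ = 0 := by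
  have hskew (x y : V) : ⟪J x, y⟫ = -⟪J y, x⟫ := by
    rw [← hJorth, hJ2, inner_neg_left, real_inner_comm]
  induction m with
  | zero => exact ⟨Fin.elim0, Fin.elim0, by simp⟩
  | succ m ih =>
    obtain ⟨v, μ, hv, hvv, hJv⟩ := ih (by lia)
    obtain ⟨w, c, hww, hw, hvw, hJw⟩ :=
      exists_unit_eigenvector_orthogonal hS hSJ (by lia : 2 * m < finrank ℝ V) v μ hv
    have hJww : ⟪J w, w⟫ = 0 := self_eq_neg.1 (hskew w w)
    refine ⟨Fin.cons w v, Fin.cons c μ, ?_, ?_, ?_⟩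
    · exact Fin.cases hw hv
    · refine Fin.cases (Fin.cases ?_ fun j => ?_) fun i => Fin.cases ?_ fun j => ?_
      · simpa using hww
      · simpa [real_inner_comm, (Fin.succ_ne_zero j).symm] using hvw j
      · simpa using hvw i
      · simpa using hvv i j
    · refine Fin.cases (Fin.cases hJww fun j => ?_) fun i => Fin.cases (hJw i) (hJv i)
      simpa [hskew w] using hJw j

/-- Any self-adjoint endomorphism `S` anticommuting with an orthogonal complex structure `J`
on a 6-dimensional real inner product space admits a unitary eigenbasis: there are an
orthonormal basis `e₀, …, e₅` and reals `μ₁, μ₂, μ₃` with `J e_{2k} = e_{2k+1}`,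
`S e_{2k} = μ_k e_{2k}` and `S e_{2k+1} = -μ_k e_{2k+1}` for `k = 0, 1, 2`. -/
theorem stmt11 (V : Type*) [NormedAddCommGroup V] [InnerProductSpace ℝ V]
    (hdim : Module.finrank ℝ V = 6)
    (J S : V →ₗ[ℝ] V)
    (hJ2 : ∀ x : V, J (J x) = -x)
    (hJorth : ∀ x y : V, ⟪J x, J y⟫ = ⟪x, y⟫)
    (hSsa : ∀ x y : V, ⟪S x, y⟫ = ⟪x, S y⟫)
    (hSJ : ∀ x : V, S (J x) = -J (S x)) :
    ∃ (e : OrthonormalBasis (Fin 6) ℝ V) (μ : Fin 3 → ℝ),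
      ∀ k : Fin 3,
        J (e ⟨2 * k.val, by omega⟩) = e ⟨2 * k.val + 1, by omega⟩ ∧
        S (e ⟨2 * k.val, by omega⟩) = μ k • e ⟨2 * k.val, by omega⟩ ∧
        S (e ⟨2 * k.val + 1, by omega⟩) = (-μ k) • e ⟨2 * k.val + 1, by omega⟩ := by
  have : FiniteDimensional ℝ V := .of_finrank_pos (by lia)
  obtain ⟨v, μ, hv, hvv, hJv⟩ :=
    exists_unitary_eigenvectors hJ2 hJorth hSsa hSJ 3 (by lia)
  let f : Fin 3 × Fin 2 → V := fun p => if p.2 = 0 then v p.1 else J (v p.1)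
  have hf : Orthonormal ℝ f := by
    rw [orthonormal_iff_ite]
    rintro ⟨i, a⟩ ⟨j, b⟩
    fin_cases a <;> fin_cases b <;> simp [f, hJorth, hvv, hJv, real_inner_comm (J _)]
  let b := (basisOfOrthonormalOfCardEqFinrank hf (by simp [hdim])).toOrthonormalBasis
    (by simpa using hf)
  have hb (p) : b p = f p := by simp [b]
  refine ⟨b.reindex finProdFinEquiv, μ, fun k => ?_⟩
  have h₀ : b.reindex finProdFinEquiv ⟨2 * k.val, by lia⟩ = v k := by
    have : finProdFinEquiv (k, (0 : Fin 2)) = ⟨2 * k.val, by lia⟩ := by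
      ext; simp [finProdFinEquiv]
    rw [← this, b.reindex_apply, Equiv.symm_apply_apply, hb]
    simp [f]
  have h₁ : b.reindex finProdFinEquiv ⟨2 * k.val + 1, by lia⟩ = J (v k) := by
    have : finProdFinEquiv (k, (1 : Fin 2)) = ⟨2 * k.val + 1, by lia⟩ := by
      ext; simp [finProdFinEquiv, add_comm]
    rw [← this, b.reindex_apply, Equiv.symm_apply_apply, hb]
    simp [f]
  rw [h₀, h₁]
  exact ⟨rfl, hv k, by rw [hSJ, hv, map_smul, neg_smul]⟩
end

section
/- Let V be a 6-dimensional real inner product space and let J : V → V be an orthogonal complex structure. Let A : V → V be a self-adjoint linear map with trace zero and A ∘ J = J ∘ A, and let S : V → V be a self-adjoint linear map with S ∘ J = −J ∘ S. If A ∘ S = S ∘ A, then there exist an orthonormal basis e₁, …, e₆ of V and real numbers λ₁, λ₂, λ₃, μ₁, μ₂, μ₃ with λ₁ + λ₂ + λ₃ = 0 such that for each k ∈ {1,2,3}: J(e_{2k−1}) = e_{2k}, A(e_{2k−1}) = λ_k·e_{2k−1}, A(e_{2k}) = λ_k·e_{2k}, S(e_{2k−1}) = μ_k·e_{2k−1},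 and S(e_{2k}) = −μ_k·e_{2k}. -/
open scoped RealInnerProductSpace

/-- A symmetric operator has an eigenvector in every nonzero finite-dimensional invariant
subspace. -/
theorem LinearMap.IsSymmetric.exists_eigenvector_mem {V : Type*} [NormedAddCommGroup V]
    [InnerProductSpace ℝ V] {T : V →ₗ[ℝ] V} (hT : T.IsSymmetric) (W : Submodule ℝ V)
    [FiniteDimensional ℝ W] (hW : W ≠ ⊥) (hTW : ∀ x ∈ W, T x ∈ W) :
    ∃ c : ℝ, ∃ v ∈ W, v ≠ 0 ∧ T v = c • v := by
  have : Nontrivial W := Submodule.nontrivial_iff_ne_bot.mpr hW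
  obtain ⟨w, hw⟩ := (hT.restrict_invariant hTW).hasEigenvalue_iSup_of_finiteDimensional
    |>.exists_hasEigenvector
  exact ⟨_, w, w.2, by simpa using hw.2, congrArg Subtype.val hw.apply_eq_smul⟩

/-- Two commuting symmetric operators have a common unit eigenvector in every nonzero
finite-dimensional subspace invariant under both. -/
theorem LinearMap.IsSymmetric.exists_common_unit_eigenvector_mem {V : Type*}
    [NormedAddCommGroup V] [InnerProductSpace ℝ V] {A S : V →ₗ[ℝ] V} (hA : A.IsSymmetric)
    (hS : S.IsSymmetric) (hAS : ∀ x, A (S x) = S (A x)) (W : Submodule ℝ V)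
    [FiniteDimensional ℝ W] (hW : W ≠ ⊥) (hAW : ∀ x ∈ W, A x ∈ W) (hSW : ∀ x ∈ W, S x ∈ W) :
    ∃ a b : ℝ, ∃ v ∈ W, ‖v‖ = 1 ∧ A v = a • v ∧ S v = b • v := by
  obtain ⟨a, u, huW, hu, hAu⟩ := hA.exists_eigenvector_mem W hW hAW
  let E : Submodule ℝ V := W ⊓ Module.End.eigenspace A a
  have hE : ∀ x, x ∈ E ↔ x ∈ W ∧ A x = a • x := fun x ↦ by
    simp [E]
  have : FiniteDimensional ℝ E := Submodule.finiteDimensional_inf_left _ _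
  have hE0 : E ≠ ⊥ := (Submodule.ne_bot_iff E).mpr ⟨u, (hE u).mpr ⟨huW, hAu⟩, hu⟩
  have hSE : ∀ x ∈ E, S x ∈ E := fun x hx ↦ by
    rw [hE] at hx ⊢
    exact ⟨hSW x hx.1, by rw [hAS, hx.2, map_smul]⟩
  obtain ⟨b, v, hvE, hv, hSv⟩ := hS.exists_eigenvector_mem E hE0 hSE
  obtain ⟨hvW, hAv⟩ := (hE v).mp hvE
  refine ⟨a, b, ‖v‖⁻¹ • v, W.smul_mem _ hvW, norm_smul_inv_norm hv, ?_, ?_⟩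
  · rw [map_smul, hAv, smul_comm]
  · rw [map_smul, hSv, smul_comm]

/-- Let `A` and `S` be commuting symmetric operators, the first commuting and the second
anticommuting with an orthogonal complex structure `J`. As long as `2 * n` does not exceed the
dimension, there are `n` vectors that are orthonormal for the associated Hermitian product and
common eigenvectors of `A` and `S`. -/
theorem exists_unitary_common_eigenvectors {V : Type*} [NormedAddCommGroup V]
    [InnerProductSpace ℝ V] [FiniteDimensional ℝ V] {J A S : V →ₗ[ℝ] V}
    (hJ2 : ∀ x, J (J x) = -x) (hJorth : ∀ x y, ⟪J x, J y⟫ = ⟪x, y⟫)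
    (hA : A.IsSymmetric) (hAJ : ∀ x, A (J x) = J (A x))
    (hS : S.IsSymmetric) (hSJ : ∀ x, S (J x) = -J (S x)) (hAS : ∀ x, A (S x) = S (A x))
    (n : ℕ) (hn : 2 * n ≤ Module.finrank ℝ V) :
    ∃ (v : Fin n → V) (a b : Fin n → ℝ), Orthonormal ℝ v ∧ (∀ i j, ⟪v i, J (v j)⟫ = 0) ∧
      (∀ i, A (v i) = a i • v i) ∧ ∀ i, S (v i) = b i • v i := by
  have hJskew : ∀ x y, ⟪J x, y⟫ = -⟪x, J y⟫ := fun x y ↦ by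
    rw [← hJorth x (J y), hJ2, inner_neg_right, neg_neg]
  induction n with
  | zero => exact ⟨Fin.elim0, Fin.elim0, Fin.elim0, ⟨fun i ↦ i.elim0, fun i ↦ i.elim0⟩,
      fun i ↦ i.elim0, fun i ↦ i.elim0, fun i ↦ i.elim0⟩
  | succ n ih =>
    obtain ⟨v, a, b, hv, hvJ, hAv, hSv⟩ := ih (by omega)
    let U : Submodule ℝ V := Submodule.span ℝ (Set.range (Sum.elim v (J ∘ v)))
    have hU : ∀ x, x ∈ Uᗮ ↔ ∀ i, ⟪v i, x⟫ = 0 ∧ ⟪v i, J x⟫ = 0 := fun x ↦ by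
      rw [← Submodule.span_singleton_le_iff_mem, Submodule.le_orthogonal_iff_le_orthogonal,
        Submodule.span_le, Set.range_subset_iff]
      simp [Submodule.mem_orthogonal_singleton_iff_inner_left, hJskew, forall_and]
    have hU0 : Uᗮ ≠ ⊥ := fun h ↦ by
      have h1 : Module.finrank ℝ U ≤ Fintype.card (Fin n ⊕ Fin n) := finrank_range_le_card _
      have h2 := U.finrank_add_finrank_orthogonal
      rw [h, finrank_bot] at h2
      simp only [Fintype.card_sum, Fintype.card_fin] at h1
      omega
    have hAU : ∀ x ∈ Uᗮ, A x ∈ Uᗮ := fun x hx ↦ by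
      rw [hU] at hx ⊢
      intro i
      rw [← hAJ, ← hA, ← hA, hAv, inner_smul_left, inner_smul_left, (hx i).1, (hx i).2]
      simp
    have hSU : ∀ x ∈ Uᗮ, S x ∈ Uᗮ := fun x hx ↦ by
      rw [hU] at hx ⊢
      intro i
      rw [← neg_neg (J (S x)), ← hSJ, inner_neg_right, ← hS, ← hS, hSv, inner_smul_left,
        inner_smul_left, (hx i).1, (hx i).2]
      simp
    obtain ⟨α, β, w, hwU, hw, hAw, hSw⟩ :=
      hA.exists_common_unit_eigenvector_mem hS hAS Uᗮ hU0 hAU hSU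
    rw [hU] at hwU
    have hwJ : ⟪w, J w⟫ = 0 := by
      have := hJskew w w
      rw [real_inner_comm] at this
      linarith
    refine ⟨Fin.cons w v, Fin.cons α a, Fin.cons β b, ?_, ?_, ?_, ?_⟩
    · rw [orthonormal_iff_ite] at hv ⊢
      intro i j
      cases i using Fin.cases <;> cases j using Fin.cases
      · simp [hw]
      · simp [real_inner_comm _ w, (hwU _).1, (Fin.succ_ne_zero _).symm]
      · simp [(hwU _).1]
      · simp [hv]
    · intro i j
      cases i using Fin.cases <;> cases j using Fin.cases
      · simpa using hwJ
      · simp [← neg_eq_zero (a := ⟪w, _⟫), ← hJskew, real_inner_comm, (hwU _).2]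
      · simp [(hwU _).2]
      · simp [hvJ]
    · intro i
      cases i using Fin.cases <;> simp [hAw, hAv]
    · intro i
      cases i using Fin.cases <;> simp [hSw, hSv]

/-- Lemma 1 of the paper: if `A` is a trace-free self-adjoint endomorphism commuting with
an orthogonal complex structure `J` on a 6-dimensional real inner product space, `S` is a
self-adjoint endomorphism anticommuting with `J`, and `A` and `S` commute, then there is a
common unitary eigenbasis: an orthonormal basis `e₀, …, e₅` and reals `λ₁, λ₂, λ₃`
(summing to zero) and `μ₁, μ₂, μ₃` with `J e_{2k} = e_{2k+1}`, `A e_{2k} = λ_k e_{2k}`,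
`A e_{2k+1} = λ_k e_{2k+1}`, `S e_{2k} = μ_k e_{2k}`, `S e_{2k+1} = -μ_k e_{2k+1}`. -/
theorem stmt13 (V : Type*) [NormedAddCommGroup V] [InnerProductSpace ℝ V]
    (hdim : Module.finrank ℝ V = 6)
    (J A S : V →ₗ[ℝ] V)
    (hJ2 : ∀ x : V, J (J x) = -x)
    (hJorth : ∀ x y : V, ⟪J x, J y⟫ = ⟪x, y⟫)
    (hAsa : ∀ x y : V, ⟪A x, y⟫ = ⟪x, A y⟫)
    (hAtr : LinearMap.trace ℝ V A = 0)
    (hAJ : ∀ x : V, A (J x) = J (A x))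
    (hSsa : ∀ x y : V, ⟪S x, y⟫ = ⟪x, S y⟫)
    (hSJ : ∀ x : V, S (J x) = -J (S x))
    (hAS : ∀ x : V, A (S x) = S (A x)) :
    ∃ (e : OrthonormalBasis (Fin 6) ℝ V) (lam μ : Fin 3 → ℝ),
      lam 0 + lam 1 + lam 2 = 0 ∧
      ∀ k : Fin 3,
        J (e ⟨2 * k.val, by omega⟩) = e ⟨2 * k.val + 1, by omega⟩ ∧
        A (e ⟨2 * k.val, by omega⟩) = lam k • e ⟨2 * k.val, by omega⟩ ∧
        A (e ⟨2 * k.val + 1, by omega⟩) = lam k • e ⟨2 * k.val + 1, by omega⟩ ∧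
        S (e ⟨2 * k.val, by omega⟩) = μ k • e ⟨2 * k.val, by omega⟩ ∧
        S (e ⟨2 * k.val + 1, by omega⟩) = (-μ k) • e ⟨2 * k.val + 1, by omega⟩ := by
  have : FiniteDimensional ℝ V := .of_finrank_pos (by omega)
  obtain ⟨v, a, b, hv, hvJ, hAv, hSv⟩ :=
    exists_unitary_common_eigenvectors hJ2 hJorth hAsa hAJ hSsa hSJ hAS 3 hdim.ge
  let f : Fin 3 × Fin 2 → V := fun p ↦ ![v p.1, J (v p.1)] p.2
  have hf : Orthonormal ℝ f := by
    rw [orthonormal_iff_ite] at hv ⊢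
    rintro ⟨i, p⟩ ⟨j, q⟩
    fin_cases p <;> fin_cases q <;> simp [f, hJorth, hv, hvJ, real_inner_comm]
  have hcard : Fintype.card (Fin 3 × Fin 2) = Module.finrank ℝ V := by simp [hdim]
  let e₀ : OrthonormalBasis (Fin 3 × Fin 2) ℝ V :=
    OrthonormalBasis.mk hf (hf.linearIndependent.span_eq_top_of_card_eq_finrank' hcard).ge
  have he₀ : ∀ k j, e₀ (k, j) = ![v k, J (v k)] j := fun k j ↦ by simp [e₀, f]
  let e : OrthonormalBasis (Fin 6) ℝ V := e₀.reindex (finProdFinEquiv : Fin 3 × Fin 2 ≃ Fin 6)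
  have he : ∀ k : Fin 3, e ⟨2 * k.val, by omega⟩ = v k ∧
      e ⟨2 * k.val + 1, by omega⟩ = J (v k) := fun k ↦ by
    have h0 : (⟨2 * k.val, by omega⟩ : Fin 6) = finProdFinEquiv (k, (0 : Fin 2)) := by
      fin_cases k <;> rfl
    have h1 : (⟨2 * k.val + 1, by omega⟩ : Fin 6) = finProdFinEquiv (k, (1 : Fin 2)) := by
      fin_cases k <;> rfl
    rw [h0, h1]
    simp [e, he₀]
  refine ⟨e, a, b, ?_, fun k ↦ ?_⟩
  · have hn : ∀ k, ⟪v k, v k⟫ = 1 := fun k ↦ by simp [hv.1 k]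
    rw [LinearMap.trace_eq_sum_inner A e₀] at hAtr
    simp [Fintype.sum_prod_type, Fin.sum_univ_three, he₀, hAJ, hAv, inner_smul_right, hJorth,
      hn, -inner_self_eq_norm_sq_to_K] at hAtr
    linarith
  · rw [(he k).1, (he k).2]
    simp [hAJ, hSJ, hAv, hSv]
end
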